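/- Let p be a prime and let G be a finite p-group of order p^n with |CD(G)| = |L(G)| - 1. Then G has a unique subgroup of order p, and the maximal Chermak-Delgado measure satisfies m*(G) = p^{n+1}. -/

import Mathlib

/-- The Chermak-Delgado measure of a subgroup `H` of `G`: `m_G(H) = |H| * |C_G(H)|`. -/
noncomputable def cdMeasure (G : Type*) [Group G] (H : Subgroup G) : ℕ :=
  Nat.card H * Nat.card (Subgroup.centralizer (H : Set G))

/-- The Chermak-Delgado lattice of `G`: the set of subgroups whose Chermak-Delgado
measure is maximal among all subgroups of `G`. -/
def cdLattice (G : Type*) [Group G] : Set (Subgroup G) :=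
  {H | ∀ K : Subgroup G, cdMeasure G K ≤ cdMeasure G H}

theorem cdMeasure_of_le_center {G : Type*} [Group G] {H : Subgroup G}
    (hH : H ≤ Subgroup.center G) : cdMeasure G H = Nat.card H * Nat.card G := by
  have : Subgroup.centralizer (H : Set G) = ⊤ :=
    Subgroup.centralizer_eq_top_iff_subset.2 hH
  simp [cdMeasure, this]

theorem cdMeasure_bot (G : Type*) [Group G] : cdMeasure G ⊥ = Nat.card G := by
  rw [cdMeasure_of_le_center bot_le, Subgroup.card_bot, one_mul]

theorem cdMeasure_top (G : Type*) [Group G] :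
    cdMeasure G ⊤ = Nat.card G * Nat.card (Subgroup.center G) := by
  simp [cdMeasure, Subgroup.centralizer_univ]

/-- If the center is nontrivial, the trivial subgroup does not have maximal measure. -/
theorem bot_notMem_cdLattice (G : Type*) [Group G] [Finite G]
    [Nontrivial (Subgroup.center G)] : (⊥ : Subgroup G) ∉ cdLattice G := fun hbot ↦ by
  have h := hbot (Subgroup.center G)
  rw [cdMeasure_bot, cdMeasure_of_le_center le_rfl] at h
  have h1 : 1 < Nat.card (Subgroup.center G) := Finite.one_lt_card
  nlinarith [Nat.card_pos (α := G)]

theorem nontrivial_of_card_cdLattice {G : Type*} [Group G] [Finite G]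
    (h : Nat.card (cdLattice G) = Nat.card (Subgroup G) - 1) : Nontrivial G := by
  by_contra hG
  rw [not_nontrivial_iff_subsingleton] at hG
  rw [Nat.card_unique (α := Subgroup G), Nat.sub_self] at h
  have hbot : (⊥ : Subgroup G) ∈ cdLattice G := fun K ↦ by rw [Subsingleton.elim K ⊥]
  have : Nonempty (cdLattice G) := ⟨⟨⊥, hbot⟩⟩
  exact Nat.card_pos.ne' h

/-- If all subgroups but one have maximal measure and the trivial one does not, then every
nontrivial subgroup has maximal measure. -/
theorem mem_cdLattice_of_ne_bot {G : Type*} [Group G] [Finite G]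
    (h : Nat.card (cdLattice G) = Nat.card (Subgroup G) - 1)
    (hbot : (⊥ : Subgroup G) ∉ cdLattice G) {H : Subgroup G} (hH : H ≠ ⊥) :
    H ∈ cdLattice G := by
  have hcompl : (cdLattice G)ᶜ.ncard ≤ 1 := by
    have h2 := Set.ncard_add_ncard_compl (cdLattice G)
    rw [← Nat.card_coe_set_eq (cdLattice G)] at h2
    omega
  by_contra hmem
  exact hH ((Set.ncard_le_one_iff (Set.toFinite _)).1 hcompl hmem hbot)

/-- If `G` is a finite `p`-group of order `p^n` with `|CD(G)| = |L(G)| - 1`, then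
`G` has a unique subgroup of order `p` and `m*(G) = p^(n+1)`. -/
theorem cd_eq_sub_one_pGroup (G : Type*) [Group G] [Finite G] (p n : ℕ) (hp : p.Prime)
    (hG : Nat.card G = p ^ n)
    (h : Nat.card (cdLattice G) = Nat.card (Subgroup G) - 1) :
    (∃! H : Subgroup G, Nat.card H = p) ∧
      IsGreatest (Set.range (cdMeasure G)) (p ^ (n + 1)) := by
  have := Fact.mk hp
  have hpG : IsPGroup p G := IsPGroup.of_card hG
  have := nontrivial_of_card_cdLattice h
  have := hpG.center_nontrivial
  have hmem {H : Subgroup G} (hH : H ≠ ⊥) : H ∈ cdLattice G :=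
    mem_cdLattice_of_ne_bot h (bot_notMem_cdLattice G) hH
  have hne {H : Subgroup G} (hH : Nat.card H = p) : H ≠ ⊥ := by
    rintro rfl
    exact hp.one_lt.ne (by simpa using hH)
  obtain ⟨P, hPcard, hPZ⟩ : ∃ P : Subgroup G, Nat.card P = p ∧ P ≤ Subgroup.center G := by
    have hdvd : p ∣ Nat.card (Subgroup.center G) :=
      (hpG.to_subgroup _).card_eq_or_dvd.resolve_left Finite.one_lt_card.ne'
    obtain ⟨z, hz⟩ := exists_prime_orderOf_dvd_card' p hdvd
    refine ⟨Subgroup.zpowers (z : G), ?_, by simp⟩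
    rw [Nat.card_zpowers, Subgroup.orderOf_coe, hz]
  have hmeasureP : cdMeasure G P = p ^ (n + 1) := by
    rw [cdMeasure_of_le_center hPZ, hPcard, hG, pow_succ']
  have hmeasure {H : Subgroup G} (hH : H ≠ ⊥) : cdMeasure G H = p ^ (n + 1) :=
    hmeasureP ▸ le_antisymm (hmem (hne hPcard) H) (hmem hH P)
  have hpos : 0 < p ^ n := pow_pos hp.pos n
  have hcenter : Nat.card (Subgroup.center G) = p := by
    have htop := hmeasure (H := ⊤) top_ne_bot
    rw [cdMeasure_top, hG, pow_succ] at htop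
    exact Nat.eq_of_mul_eq_mul_left hpos htop
  refine ⟨⟨P, hPcard, fun H hH ↦ ?_⟩, ⟨P, hmeasureP⟩, ?_⟩
  · have hcent : Nat.card (Subgroup.centralizer (H : Set G)) = Nat.card G := by
      have hm := hmeasure (hne hH)
      rw [cdMeasure, hH, pow_succ'] at hm
      rw [hG]
      exact Nat.eq_of_mul_eq_mul_left hp.pos hm
    have hHZ : H ≤ Subgroup.center G :=
      Subgroup.centralizer_eq_top_iff_subset.1 (Subgroup.eq_top_of_card_eq _ hcent)
    rw [Subgroup.eq_of_le_of_card_ge hHZ (by rw [hcenter, hH]),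
      Subgroup.eq_of_le_of_card_ge hPZ (by rw [hcenter, hPcard])]
  · rintro _ ⟨K, rfl⟩
    exact hmeasureP ▸ hmem (hne hPcard) K
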